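/- arXiv:1111.5642 — 6 statements merged into one kernel-verified Lean document; each statement's English description precedes it below -/
import Mathlib

section
/- Let H be a complex Hilbert space, let J : H → H be a conjugation, and let T : H →L[ℂ] H be a bounded linear operator that is J-symmetric. If T is hyponormal, i.e., ‖T* f‖ ≤ ‖T f‖ for every f ∈ H, then ‖T f‖ = ‖T* f‖ for every f ∈ H, and consequently T is normal: T ∘ T* = T* ∘ T. -/
open ContinuousLinearMap

/-- If a `J`-symmetric bounded operator `T` on a complex Hilbert space is hyponormal,
then `‖T f‖ = ‖T* f‖` for every `f`, and `T` is normal. -/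
theorem hyponormal_complex_symmetric_is_normal
    {H : Type*} [NormedAddCommGroup H] [InnerProductSpace ℂ H] [CompleteSpace H]
    (J : H → H)
    (hJadd : ∀ x y : H, J (x + y) = J x + J y)
    (hJsmul : ∀ (c : ℂ) (x : H), J (c • x) = (starRingEnd ℂ) c • J x)
    (hJiso : ∀ x : H, ‖J x‖ = ‖x‖)
    (hJinv : ∀ x : H, J (J x) = x)
    (T : H →L[ℂ] H)
    (hsym : ∀ x : H, T x = J ((ContinuousLinearMap.adjoint T) (J x)))
    (hhypo : ∀ f : H, ‖(ContinuousLinearMap.adjoint T) f‖ ≤ ‖T f‖) :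
    (∀ f : H, ‖T f‖ = ‖(ContinuousLinearMap.adjoint T) f‖) ∧
      T ∘L (ContinuousLinearMap.adjoint T) = (ContinuousLinearMap.adjoint T) ∘L T := by
  have h : ∀ f : H, ‖T f‖ = ‖(ContinuousLinearMap.adjoint T) f‖ := by
    intro f
    refine le_antisymm ?_ (hhypo f)
    calc ‖T f‖ = ‖(ContinuousLinearMap.adjoint T) (J f)‖ := by rw [hsym f, hJiso]
      _ ≤ ‖T (J f)‖ := hhypo (J f)
      _ = ‖(ContinuousLinearMap.adjoint T) f‖ := by rw [hsym (J f), hJiso, hJinv]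
  refine ⟨h, ?_⟩
  have hn : IsStarNormal T := ContinuousLinearMap.isStarNormal_iff_norm_eq_adjoint.mpr h
  exact hn.star_comm_self.eq.symm
end

section
/- Let φ : ℂ → ℂ be holomorphic on the open unit disk 𝔻 with φ(𝔻) ⊆ 𝔻, and suppose that (1 − φ(w)·z)·(1 − φ(0)·w) = (1 − φ(z)·w)·(1 − φ(0)·z) for all z, w ∈ 𝔻. Then there exists a₁ ∈ ℂ such that φ(z) = φ(0) + a₁·z/(1 − φ(0)·z) for all z ∈ 𝔻 (equivalently, φ(z)·(1 − φ(0)·z) = φ(0)·(1 − φ(0)·z) + a₁·z for all z ∈ 𝔻). -/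
open Metric

/-- If a holomorphic self-map `φ` of the unit disk satisfies the symmetry identity
`(1 − φ(w)z)(1 − φ(0)w) = (1 − φ(z)w)(1 − φ(0)z)` for all `z, w ∈ 𝔻`, then
`φ(z) = φ(0) + a₁ z / (1 − φ(0) z)` on `𝔻` for some constant `a₁`. -/
theorem symbol_form_of_kernel_symmetry
    (φ : ℂ → ℂ)
    (hφ : DifferentiableOn ℂ φ (Metric.ball (0 : ℂ) 1))
    (hmaps : ∀ z ∈ Metric.ball (0 : ℂ) 1, φ z ∈ Metric.ball (0 : ℂ) 1)
    (hsym : ∀ z ∈ Metric.ball (0 : ℂ) 1, ∀ w ∈ Metric.ball (0 : ℂ) 1,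
      (1 - φ w * z) * (1 - φ 0 * w) = (1 - φ z * w) * (1 - φ 0 * z)) :
    ∃ a₁ : ℂ, ∀ z ∈ Metric.ball (0 : ℂ) 1,
      φ z = φ 0 + a₁ * z / (1 - φ 0 * z) := by
  refine ⟨2 * (φ (1/2) * (1 - φ 0 * (1/2)) - φ 0) + φ 0 ^ 2, fun z hz => ?_⟩
  have h0 : ‖φ 0‖ < 1 := by
    simpa using hmaps 0 (by simp)
  have hz1 : ‖z‖ < 1 := by simpa using hz
  have hne : 1 - φ 0 * z ≠ 0 := by
    intro h
    have h1 : φ 0 * z = 1 := (sub_eq_zero.mp h).symm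
    have h2 : ‖φ 0‖ * ‖z‖ = 1 := by rw [← norm_mul, h1, norm_one]
    nlinarith [norm_nonneg (φ 0), norm_nonneg z]
  have hs := hsym z hz (1/2) (by simp; norm_num)
  have key : φ z * (1 - φ 0 * z) = φ 0 * (1 - φ 0 * z)
      + (2 * (φ (1/2) * (1 - φ 0 * (1/2)) - φ 0) + φ 0 ^ 2) * z := by
    linear_combination 2 * hs
  rw [← sub_eq_iff_eq_add', eq_div_iff hne]
  linear_combination key
end

section
/- Let κ be a real number with κ ≥ 1, and let ψ, φ : ℂ → ℂ be holomorphic on the open unit disk 𝔻 with φ(𝔻) ⊆ 𝔻. Suppose that ψ(z)·(1 − w·φ(z))^(−κ) = ψ(w)·(1 − φ(w)·z)^(−κ) for all z, w ∈ 𝔻, where powers are principal complex powers. Then: (i) ψ(z) = ψ(0)·(1 − φ(0)·z)^(−κ) for all z ∈ 𝔻; and (ii) if ψ(0) ≠ 0, then there exists a₁ ∈ ℂ such that φ(z) = φ(0) + a₁·z/(1 − φ(0)·z) for all z ∈ 𝔻. -/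
open Metric

/-- The "only if" direction of Proposition 9: if
`ψ(z)(1 − wφ(z))^(−κ) = ψ(w)(1 − φ(w)z)^(−κ)` on `𝔻 × 𝔻`, then
`ψ(z) = ψ(0)(1 − φ(0)z)^(−κ)` and, when `ψ(0) ≠ 0`,
`φ(z) = φ(0) + a₁ z / (1 − φ(0) z)` for some constant `a₁`. -/
theorem J_symmetric_weighted_composition_form
    (κ : ℝ) (hκ : 1 ≤ κ)
    (ψ φ : ℂ → ℂ)
    (hψ : DifferentiableOn ℂ ψ (Metric.ball (0 : ℂ) 1))
    (hφ : DifferentiableOn ℂ φ (Metric.ball (0 : ℂ) 1))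
    (hmaps : ∀ z ∈ Metric.ball (0 : ℂ) 1, φ z ∈ Metric.ball (0 : ℂ) 1)
    (hsym : ∀ z ∈ Metric.ball (0 : ℂ) 1, ∀ w ∈ Metric.ball (0 : ℂ) 1,
      ψ z * (1 - w * φ z) ^ (-(κ : ℂ)) = ψ w * (1 - φ w * z) ^ (-(κ : ℂ))) :
    (∀ z ∈ Metric.ball (0 : ℂ) 1, ψ z = ψ 0 * (1 - φ 0 * z) ^ (-(κ : ℂ))) ∧
      (ψ 0 ≠ 0 → ∃ a₁ : ℂ, ∀ z ∈ Metric.ball (0 : ℂ) 1,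
        φ z = φ 0 + a₁ * z / (1 - φ 0 * z)) := by
  have h0 : (0 : ℂ) ∈ Metric.ball (0 : ℂ) 1 := by simp
  have h1 : ∀ z ∈ Metric.ball (0 : ℂ) 1, ψ z = ψ 0 * (1 - φ 0 * z) ^ (-(κ : ℂ)) := by
    intro z hz
    have h := hsym z hz 0 h0
    simpa using h
  refine ⟨h1, fun hne => ?_⟩
  have hκ0 : (κ : ℂ) ≠ 0 := by
    have : κ ≠ 0 := by linarith
    exact_mod_cast this
  have hnhds : Metric.ball (0 : ℂ) 1 ∈ nhds (0 : ℂ) := Metric.isOpen_ball.mem_nhds h0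
  have dψ := (hψ.differentiableAt hnhds).hasDerivAt
  have dφ := (hφ.differentiableAt hnhds).hasDerivAt
  have key : ∀ z ∈ Metric.ball (0 : ℂ) 1, (1 - φ 0 * z) ≠ 0 ∧
      ψ 0 * (κ * φ z) = deriv ψ 0 + ψ 0 * (κ * (deriv φ 0 * z / (1 - φ 0 * z))) := by
    intro z hz
    have hlt : ‖φ 0 * z‖ < 1 := by
      have a := hmaps 0 h0
      rw [mem_ball_zero_iff] at a hz
      rw [norm_mul]
      nlinarith [norm_nonneg (φ 0), norm_nonneg z]
    have hslit : (1 - φ 0 * z) ∈ Complex.slitPlane := by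
      left
      have := Complex.re_le_norm (φ 0 * z)
      rw [Complex.sub_re, Complex.one_re]
      linarith
    have hu : (1 - φ 0 * z) ≠ 0 := Complex.slitPlane_ne_zero hslit
    refine ⟨hu, ?_⟩
    have dL : HasDerivAt (fun w : ℂ => ψ z * (1 - w * φ z) ^ (-(κ : ℂ)))
        (ψ z * (-(κ : ℂ) * (1 - 0 * φ z) ^ (-(κ : ℂ) - 1) * (-(1 * φ z)))) 0 :=
      ((((hasDerivAt_id (0 : ℂ)).mul_const (φ z)).const_sub 1).cpow_const
        (by simp)).const_mul (ψ z)
    have dR : HasDerivAt (fun w : ℂ => ψ w * (1 - φ w * z) ^ (-(κ : ℂ)))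
        (deriv ψ 0 * (1 - φ 0 * z) ^ (-(κ : ℂ)) +
          ψ 0 * (-(κ : ℂ) * (1 - φ 0 * z) ^ (-(κ : ℂ) - 1) * (-(deriv φ 0 * z)))) 0 :=
      dψ.mul (((dφ.mul_const z).const_sub 1).cpow_const hslit)
    have heq : (fun w : ℂ => ψ z * (1 - w * φ z) ^ (-(κ : ℂ))) =ᶠ[nhds 0]
        (fun w : ℂ => ψ w * (1 - φ w * z) ^ (-(κ : ℂ))) := by
      filter_upwards [hnhds] with w hw using hsym z hz w hw
    have h := dL.unique (dR.congr_of_eventuallyEq heq)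
    rw [h1 z hz, Complex.cpow_sub _ _ hu, Complex.cpow_one] at h
    have hp : (1 - φ 0 * z) ^ (-(κ : ℂ)) ≠ 0 := by
      simp [Complex.cpow_eq_zero_iff, hu]
    simp only [zero_mul, sub_zero, Complex.one_cpow, mul_one, one_mul] at h
    apply mul_right_cancel₀ hp
    linear_combination h
  have k0 := (key 0 h0).2
  refine ⟨deriv φ 0, fun z hz => ?_⟩
  have k := (key z hz).2
  apply mul_left_cancel₀ (mul_ne_zero hne hκ0)
  simp only [mul_zero, zero_div, add_zero] at k0
  linear_combination k - k0
end

section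
/- Let κ be a real number with κ ≥ 1 and let b, a₀, a₁ ∈ ℂ. Define ψ(z) = b·(1 − a₀·z)^(−κ) and φ(z) = a₀ + a₁·z/(1 − a₀·z), and assume |a₀| < 1 and φ(𝔻) ⊆ 𝔻. Then ψ(z)·(1 − w·φ(z))^(−κ) = ψ(w)·(1 − φ(w)·z)^(−κ) for all z, w ∈ 𝔻, where powers are principal complex powers. -/
open Metric

lemma aux_re_pos {u v : ℂ} (hu : ‖u‖ < 1) (hv : ‖v‖ < 1) : 0 < (1 - u * v).re := by
  have h1 : ‖u * v‖ < 1 := by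
    rw [norm_mul]
    nlinarith [norm_nonneg u, norm_nonneg v]
  have h2 := (Complex.re_le_norm (u * v)).trans_lt h1
  rw [Complex.sub_re, Complex.one_re]
  linarith

lemma aux_ne {u : ℂ} (hu : 0 < u.re) : u ≠ 0 := by
  rintro rfl
  simp at hu

lemma aux_mul_cpow {u v : ℂ} (hu : 0 < u.re) (hv : 0 < v.re) (c : ℂ) :
    u ^ c * v ^ c = (u * v) ^ c := by
  have hu0 := aux_ne hu
  have hv0 := aux_ne hv
  have h1 := abs_lt.mp (Complex.abs_arg_lt_pi_div_two_iff.mpr (Or.inl hu))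
  have h2 := abs_lt.mp (Complex.abs_arg_lt_pi_div_two_iff.mpr (Or.inl hv))
  have hl : Complex.log (u * v) = Complex.log u + Complex.log v :=
    (Complex.log_mul_eq_add_log_iff hu0 hv0).mpr
      ⟨by linarith [h1.1, h2.1], by linarith [h1.2, h2.2]⟩
  rw [Complex.cpow_def_of_ne_zero hu0, Complex.cpow_def_of_ne_zero hv0,
    Complex.cpow_def_of_ne_zero (mul_ne_zero hu0 hv0), hl, ← Complex.exp_add, add_mul]

/-- The "if" direction of Proposition 9: with `ψ(z) = b(1 − a₀z)^(−κ)` and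
`φ(z) = a₀ + a₁ z / (1 − a₀ z)` mapping `𝔻` into `𝔻`, the kernel symmetry identity
`ψ(z)(1 − wφ(z))^(−κ) = ψ(w)(1 − φ(w)z)^(−κ)` holds on `𝔻 × 𝔻`. -/
theorem weighted_composition_is_J_symmetric
    (κ : ℝ) (hκ : 1 ≤ κ) (b a₀ a₁ : ℂ)
    (ψ φ : ℂ → ℂ)
    (hψdef : ∀ z : ℂ, ψ z = b * (1 - a₀ * z) ^ (-(κ : ℂ)))
    (hφdef : ∀ z : ℂ, φ z = a₀ + a₁ * z / (1 - a₀ * z))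
    (ha₀ : ‖a₀‖ < 1)
    (hmaps : ∀ z ∈ Metric.ball (0 : ℂ) 1, φ z ∈ Metric.ball (0 : ℂ) 1) :
    ∀ z ∈ Metric.ball (0 : ℂ) 1, ∀ w ∈ Metric.ball (0 : ℂ) 1,
      ψ z * (1 - w * φ z) ^ (-(κ : ℂ)) = ψ w * (1 - φ w * z) ^ (-(κ : ℂ)) := by
  intro z hz w hw
  have hfz := hmaps z hz
  have hfw := hmaps w hw
  rw [mem_ball_zero_iff] at hz hw hfz hfw
  have p1 := aux_re_pos ha₀ hz
  have p2 := aux_re_pos ha₀ hw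
  have p3 := aux_re_pos hw hfz
  have p4 := aux_re_pos hfw hz
  have n1 := aux_ne p1
  have n2 := aux_ne p2
  rw [hψdef z, hψdef w, mul_assoc, mul_assoc, aux_mul_cpow p1 p3, aux_mul_cpow p2 p4]
  have key : (1 - a₀ * z) * (1 - w * φ z) = (1 - a₀ * w) * (1 - φ w * z) := by
    have e1 : (1 - a₀ * z) * φ z = a₀ * (1 - a₀ * z) + a₁ * z := by
      rw [hφdef, mul_add, mul_div_cancel₀ _ n1]; ring
    have e2 : (1 - a₀ * w) * φ w = a₀ * (1 - a₀ * w) + a₁ * w := by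
      rw [hφdef, mul_add, mul_div_cancel₀ _ n2]; ring
    linear_combination (-w) * e1 + z * e2
  rw [key]
end

section
/- Let a₀, a₁ ∈ ℂ with |a₀| < 1, define φ(z) = a₀ + a₁·z/(1 − a₀·z), and assume φ(𝔻) ⊆ 𝔻. Define φ̃(z) = conj(φ(conj z)). Then the identity (1 − conj(a₀)·w)·(1 − a₀·z)·(1 − φ̃(w)·φ(z)) = (1 − a₀·w)·(1 − conj(a₀)·z)·(1 − φ(w)·φ̃(z)) holds for all z, w ∈ 𝔻 if and only if Im(a₀·conj(a₁)) = (1 − |a₀|²)·Im(a₀). -/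
open Metric

/-- Functional form of the normality condition from Proposition 9: for
`φ(z) = a₀ + a₁ z / (1 − a₀ z)` and `φ̃(z) = conj(φ(conj z))`, the identity
`(1 − conj(a₀)w)(1 − a₀z)(1 − φ̃(w)φ(z)) = (1 − a₀w)(1 − conj(a₀)z)(1 − φ(w)φ̃(z))`
holds on `𝔻 × 𝔻` iff `Im(a₀ conj(a₁)) = (1 − |a₀|²) Im(a₀)`. -/
theorem normality_condition_iff
    (a₀ a₁ : ℂ) (ha₀ : ‖a₀‖ < 1)
    (φ : ℂ → ℂ)
    (hφdef : ∀ z : ℂ, φ z = a₀ + a₁ * z / (1 - a₀ * z))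
    (hmaps : ∀ z ∈ Metric.ball (0 : ℂ) 1, φ z ∈ Metric.ball (0 : ℂ) 1) :
    (∀ z ∈ Metric.ball (0 : ℂ) 1, ∀ w ∈ Metric.ball (0 : ℂ) 1,
        (1 - (starRingEnd ℂ) a₀ * w) * (1 - a₀ * z) *
            (1 - (starRingEnd ℂ) (φ ((starRingEnd ℂ) w)) * φ z) =
          (1 - a₀ * w) * (1 - (starRingEnd ℂ) a₀ * z) *
            (1 - φ w * (starRingEnd ℂ) (φ ((starRingEnd ℂ) z)))) ↔
      (a₀ * (starRingEnd ℂ) a₁).im = (1 - ‖a₀‖ ^ 2) * a₀.im := by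
  have hne : ∀ u z : ℂ, ‖u‖ < 1 → z ∈ Metric.ball (0 : ℂ) 1 → 1 - u * z ≠ 0 := by
    intro u z hu hz h
    have hz' : ‖z‖ < 1 := by simpa using hz
    have h1 : u * z = 1 := (sub_eq_zero.mp h).symm
    have h2 : ‖u‖ * ‖z‖ = 1 := by rw [← norm_mul, h1, norm_one]
    nlinarith [norm_nonneg u, norm_nonneg z]
  have hA : ‖(starRingEnd ℂ) a₀‖ < 1 := by simpa using ha₀
  have hsq : ((‖a₀‖ ^ 2 : ℝ) : ℂ) = a₀ * (starRingEnd ℂ) a₀ := by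
    rw [Complex.mul_conj, Complex.normSq_eq_norm_sq]
  have hK : (a₀ * (starRingEnd ℂ) a₁ - (starRingEnd ℂ) a₀ * a₁)
      - (1 - a₀ * (starRingEnd ℂ) a₀) * (a₀ - (starRingEnd ℂ) a₀)
      = ((2 * ((a₀ * (starRingEnd ℂ) a₁).im - (1 - ‖a₀‖ ^ 2) * a₀.im) : ℝ) : ℂ) * Complex.I := by
    have e1 : a₀ * (starRingEnd ℂ) a₁ - (starRingEnd ℂ) a₀ * a₁
        = ((2 * (a₀ * (starRingEnd ℂ) a₁).im : ℝ) : ℂ) * Complex.I := by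
      rw [← Complex.sub_conj]; simp
    have e2 := Complex.sub_conj a₀
    rw [e1, e2, ← hsq]
    push_cast
    ring
  have key : ∀ z ∈ Metric.ball (0 : ℂ) 1, ∀ w ∈ Metric.ball (0 : ℂ) 1,
        (1 - (starRingEnd ℂ) a₀ * w) * (1 - a₀ * z) *
            (1 - (starRingEnd ℂ) (φ ((starRingEnd ℂ) w)) * φ z) -
          (1 - a₀ * w) * (1 - (starRingEnd ℂ) a₀ * z) *
            (1 - φ w * (starRingEnd ℂ) (φ ((starRingEnd ℂ) z)))
        = (z - w) * (((2 * ((a₀ * (starRingEnd ℂ) a₁).im - (1 - ‖a₀‖ ^ 2) * a₀.im) : ℝ) : ℂ)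
            * Complex.I) := by
    intro z hz w hw
    rw [← hK]
    have h1 := hne _ _ ha₀ hz
    have h2 := hne _ _ ha₀ hw
    have h3 := hne _ _ hA hz
    have h4 := hne _ _ hA hw
    simp only [hφdef, map_add, map_div₀, map_mul, map_sub, map_one, Complex.conj_conj]
    generalize (starRingEnd ℂ) a₀ = A at *
    generalize (starRingEnd ℂ) a₁ = B at *
    have h1' : 1 - z * a₀ ≠ 0 := by rwa [mul_comm]
    have h2' : 1 - w * a₀ ≠ 0 := by rwa [mul_comm]
    have h3' : 1 - z * A ≠ 0 := by rwa [mul_comm]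
    have h4' : 1 - w * A ≠ 0 := by rwa [mul_comm]
    field_simp
    ring
  constructor
  · intro h
    have h0 : (1 / 2 : ℂ) ∈ Metric.ball (0 : ℂ) 1 := by
      simp; norm_num
    have h1 : (0 : ℂ) ∈ Metric.ball (0 : ℂ) 1 := by simp
    have h2 := key _ h0 _ h1
    rw [sub_eq_zero.mpr (h _ h0 _ h1)] at h2
    have h3 := congrArg Complex.im h2
    simp only [sub_zero, ← mul_assoc, Complex.mul_I_im, Complex.zero_im] at h3
    rw [Complex.re_mul_ofReal] at h3
    have h4 : (1 / 2 : ℂ).re = 1 / 2 := by norm_num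
    rw [h4] at h3
    linarith
  · intro h z hz w hw
    have := key z hz w hw
    rw [h, sub_self] at this
    apply sub_eq_zero.mp
    rw [this]
    simp
end

section
/- Let F : ℂ → ℂ be holomorphic and injective on the open unit disk 𝔻, let w₀ ∈ 𝔻 with F(w₀) = 0, and let λ ∈ ℂ with 0 < |λ| < 1. Suppose that λ·F(z) ∈ F(𝔻) for every z ∈ 𝔻. Then there exists a function φ : ℂ → ℂ, holomorphic on 𝔻, such that φ(𝔻) ⊆ 𝔻, φ is injective on 𝔻, φ(w₀) = w₀, and F(φ(z)) = λ·F(z) for all z ∈ 𝔻. In particular, φ is a univalent holomorphic self-map of 𝔻 fixing w₀ whose Koenigs eigenfunction is F. -/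
open Metric

open Filter Topology in
lemma koenigs_not_const {F : ℂ → ℂ} (hFinj : Set.InjOn F (Metric.ball (0 : ℂ) 1))
    {w : ℂ} (hw : w ∈ Metric.ball (0 : ℂ) 1) : ¬ ∀ᶠ z in 𝓝 w, F z = F w := by
  intro h
  have h2 : ∀ᶠ z in 𝓝 w, z = w := by
    filter_upwards [h, isOpen_ball.mem_nhds hw] with z hz hzb using hFinj hzb hw hz
  have h3 : ∀ᶠ z in 𝓝[≠] w, False := by
    filter_upwards [h2.filter_mono nhdsWithin_le_nhds, self_mem_nhdsWithin] with z hz hz'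
    exact hz' hz
  simpa using h3.exists

open Filter Topology in
lemma koenigs_inv {F : ℂ → ℂ}
    (hF : DifferentiableOn ℂ F (Metric.ball (0 : ℂ) 1))
    (hFinj : Set.InjOn F (Metric.ball (0 : ℂ) 1)) {G : ℂ → ℂ}
    (hG : ∀ z ∈ Metric.ball (0 : ℂ) 1, G (F z) = z)
    {w : ℂ} (hw : w ∈ Metric.ball (0 : ℂ) 1) : DifferentiableAt ℂ G (F w) := by
  have han : ∀ z ∈ ball (0 : ℂ) 1, AnalyticAt ℂ F z := fun z hz =>
    hF.analyticAt (isOpen_ball.mem_nhds hz)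
  have hop : ∀ z ∈ ball (0 : ℂ) 1, 𝓝 (F z) ≤ map F (𝓝 z) := fun z hz =>
    (han z hz).eventually_constant_or_nhds_le_map_nhds.resolve_left (koenigs_not_const hFinj hz)
  have himg : ∀ z ∈ ball (0 : ℂ) 1, ∀ p : ℂ → Prop, (∀ᶠ u in 𝓝 z, p u) →
      ∀ᶠ y in 𝓝 (F z), ∃ u ∈ ball (0 : ℂ) 1, p u ∧ F u = y := by
    intro z hz p hp
    apply hop z hz
    rw [mem_map]
    filter_upwards [hp, isOpen_ball.mem_nhds hz] with u hu hub
    exact ⟨u, hub, hu, rfl⟩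
  have hcont : ∀ z ∈ ball (0 : ℂ) 1, ContinuousAt G (F z) := by
    intro z hz
    rw [ContinuousAt, hG z hz]
    intro U hU
    rw [Filter.mem_map]
    filter_upwards [himg z hz (· ∈ U) hU] with y hy
    obtain ⟨u, hub, hu, rfl⟩ := hy
    simpa [hG u hub] using hu
  have hdiff : ∀ z ∈ ball (0 : ℂ) 1, deriv F z ≠ 0 → DifferentiableAt ℂ G (F z) := by
    intro z hz hd
    have h1 : HasDerivAt F (deriv F z) (G (F z)) := by
      rw [hG z hz]; exact (han z hz).differentiableAt.hasDerivAt
    refine (HasDerivAt.of_local_left_inverse (hcont z hz) h1 hd ?_).differentiableAt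
    filter_upwards [himg z hz (fun _ => True) (by simp)] with y hy
    obtain ⟨u, hub, hu, rfl⟩ := hy
    rw [hG u hub]
  have hne : ∀ᶠ z in 𝓝[≠] w, deriv F z ≠ 0 := by
    refine (han w hw).deriv.eventually_eq_zero_or_eventually_ne_zero.resolve_left ?_
    intro h
    apply koenigs_not_const hFinj hw
    obtain ⟨r, hr, hrs⟩ := Metric.eventually_nhds_iff_ball.1 (h.and (isOpen_ball.mem_nhds hw))
    filter_upwards [ball_mem_nhds w hr] with z hz
    exact isOpen_ball.is_const_of_deriv_eq_zero (convex_ball w r).isPreconnected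
      (hF.mono fun x hx => (hrs x hx).2) (fun x hx => (hrs x hx).1) hz (mem_ball_self hr)
  refine (Complex.analyticAt_of_differentiable_on_punctured_nhds_of_continuousAt ?_
    (hcont w hw)).differentiableAt
  rw [eventually_nhdsWithin_iff] at hne ⊢
  filter_upwards [himg w hw _ hne] with y hy hyw
  obtain ⟨u, hub, hu, rfl⟩ := hy
  exact hdiff u hub (hu fun h => hyw (by rw [Set.mem_singleton_iff] at h ⊢; rw [h]))

/-- Construction of a univalent self-map of the disk with prescribed Koenigs
eigenfunction: if `F` is holomorphic and injective on `𝔻`, vanishes at `w₀ ∈ 𝔻`,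
`0 < |μ| < 1`, and `μ • F(𝔻) ⊆ F(𝔻)`, then there is a holomorphic, injective
self-map `φ` of `𝔻` fixing `w₀` with `F ∘ φ = μ F` on `𝔻`. -/
theorem koenigs_construction
    (F : ℂ → ℂ)
    (hF : DifferentiableOn ℂ F (Metric.ball (0 : ℂ) 1))
    (hFinj : Set.InjOn F (Metric.ball (0 : ℂ) 1))
    (w₀ : ℂ) (hw₀ : w₀ ∈ Metric.ball (0 : ℂ) 1) (hFw₀ : F w₀ = 0)
    (μ : ℂ) (hμ0 : 0 < ‖μ‖) (hμ1 : ‖μ‖ < 1)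
    (hμF : ∀ z ∈ Metric.ball (0 : ℂ) 1, μ * F z ∈ F '' Metric.ball (0 : ℂ) 1) :
    ∃ φ : ℂ → ℂ,
      DifferentiableOn ℂ φ (Metric.ball (0 : ℂ) 1) ∧
      (∀ z ∈ Metric.ball (0 : ℂ) 1, φ z ∈ Metric.ball (0 : ℂ) 1) ∧
      Set.InjOn φ (Metric.ball (0 : ℂ) 1) ∧
      φ w₀ = w₀ ∧
      (∀ z ∈ Metric.ball (0 : ℂ) 1, F (φ z) = μ * F z) := by
  have hG : ∀ z ∈ ball (0 : ℂ) 1, Function.invFunOn F (ball (0 : ℂ) 1) (F z) = z :=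
    fun z hz => hFinj.leftInvOn_invFunOn hz
  generalize Function.invFunOn F (ball (0 : ℂ) 1) = G at hG
  have key : ∀ z ∈ ball (0 : ℂ) 1, G (μ * F z) ∈ ball (0 : ℂ) 1 ∧ F (G (μ * F z)) = μ * F z := by
    intro z hz
    obtain ⟨u, hu, h⟩ := hμF z hz
    rw [← h, hG u hu]
    exact ⟨hu, rfl⟩
  refine ⟨fun z => G (μ * F z), ?_, fun z hz => (key z hz).1, ?_, ?_, fun z hz => (key z hz).2⟩
  · intro z hz
    obtain ⟨u, hu, h⟩ := hμF z hz
    have h1 : DifferentiableAt ℂ G (μ * F z) := h ▸ koenigs_inv hF hFinj hG hu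
    exact DifferentiableAt.comp_differentiableWithinAt (g := G) (f := fun z => μ * F z) z h1
      ((hF z hz).const_mul μ)
  · intro a ha b hb hab
    have h : μ * F a = μ * F b := by
      rw [← (key a ha).2, ← (key b hb).2]; exact congrArg F hab
    exact hFinj ha hb (mul_left_cancel₀ (norm_pos_iff.1 hμ0) h)
  · have := hG w₀ hw₀
    simpa [hFw₀] using this
end
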